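/- Let G₁, G₂ be coloured graphs with distinguished tuples w₁ = (w₁₁,…,w₁ₘ) and w₂ = (w₂₁,…,w₂ₘ) having the same atomic q-type, and let G₁', G₂' be obtained by deleting these tuples and, for each 1 ≤ i ≤ f_q(ℓ) and 1 ≤ j ≤ m, marking with a fresh unary predicate Q_{ij} the vertices at distance exactly i from the j-th deleted vertex. If (G₁', v₁) ≡⁺_{q,ℓ} (G₂', v₂) for tuples v₁, v₂ of the remaining vertices, then (G₁, v₁w₁) ≡⁺_{q,ℓ} (G₂, v₂w₂). -/

import Mathlib

/-- FO⁺ over coloured graphs: first-order logic with equality, adjacency, colour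
predicates (indexed by `C`) and atomic distance formulas `dist(x,y) ≤ d`, with free
variables among `Fin n`. -/
inductive FOc (C : Type*) : ℕ → Type _
  | eq {n : ℕ} (i j : Fin n) : FOc C n
  | adj {n : ℕ} (i j : Fin n) : FOc C n
  | col {n : ℕ} (c : C) (i : Fin n) : FOc C n
  | distLe {n : ℕ} (i j : Fin n) (d : ℕ) : FOc C n
  | not {n : ℕ} (φ : FOc C n) : FOc C n
  | or {n : ℕ} (φ ψ : FOc C n) : FOc C n
  | ex {n : ℕ} (φ : FOc C (n + 1)) : FOc C n

/-- Semantics of FO⁺ on a coloured graph `(G, P)`. -/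
def FOc.Realize {C V : Type*} (G : SimpleGraph V) (P : C → Set V) :
    ∀ {n : ℕ}, FOc C n → (Fin n → V) → Prop
  | _, .eq i j, a => a i = a j
  | _, .adj i j, a => G.Adj (a i) (a j)
  | _, .col c i, a => a i ∈ P c
  | _, .distLe i j d, a => G.edist (a i) (a j) ≤ (d : ℕ∞)
  | _, .not φ, a => ¬ FOc.Realize G P φ a
  | _, .or φ ψ, a => FOc.Realize G P φ a ∨ FOc.Realize G P ψ a
  | _, .ex φ, a => ∃ x : V, FOc.Realize G P φ (Fin.snoc a x)

/-- `φ.QRankLe q ℓ`: quantifier rank at most `ℓ`, and every distance atom in the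
scope of `i` quantifiers has distance bound at most `(4q)^(q+ℓ-i)`. -/
def FOc.QRankLe {C : Type*} (q : ℕ) : ℕ → ∀ {n : ℕ}, FOc C n → Prop
  | _, _, .eq _ _ => True
  | _, _, .adj _ _ => True
  | _, _, .col _ _ => True
  | ℓ, _, .distLe _ _ d => d ≤ (4 * q) ^ (q + ℓ)
  | ℓ, _, .not φ => FOc.QRankLe q ℓ φ
  | ℓ, _, .or φ ψ => FOc.QRankLe q ℓ φ ∧ FOc.QRankLe q ℓ ψ
  | 0, _, .ex _ => False
  | (ℓ + 1), _, .ex φ => FOc.QRankLe q ℓ φ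

namespace SimpleGraph

variable {V : Type*} {G : SimpleGraph V}

lemma edist_le_iff_exists_walk {u v : V} {d : ℕ} :
    G.edist u v ≤ (d : ℕ∞) ↔ ∃ p : G.Walk u v, p.length ≤ d := by
  constructor
  · intro h
    have hr : G.Reachable u v := by
      rw [← edist_ne_top_iff_reachable]
      exact ne_top_of_le_ne_top (ENat.natCast_ne_top d) h
    obtain ⟨p, hp⟩ := hr.exists_walk_length_eq_edist
    exact ⟨p, by rw [← hp] at h; exact_mod_cast h⟩
  · rintro ⟨p, hp⟩
    exact (edist_le p).trans (by exact_mod_cast hp)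

lemma exists_edist_eq_succ {u v : V} {d : ℕ} (hne : u ≠ v) (h : G.edist u v ≤ (d : ℕ∞)) :
    ∃ i < d, G.edist u v = ((i + 1 : ℕ) : ℕ∞) := by
  obtain ⟨n, hn⟩ := ENat.ne_top_iff_exists.mp (ne_top_of_le_ne_top (ENat.natCast_ne_top d) h)
  rw [← hn] at h
  have hnd : n ≤ d := by exact_mod_cast h
  cases n with
  | zero => exact absurd (G.edist_eq_zero_iff.mp hn.symm) hne
  | succ i => exact ⟨i, hnd, hn.symm⟩

lemma edist_le_iff_exists_edist_eq_succ {u v : V} {d N : ℕ} (hd : d ≤ N) (hne : u ≠ v) :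
    G.edist u v ≤ (d : ℕ∞) ↔
      ∃ i : Fin N, (i : ℕ) + 1 ≤ d ∧ G.edist u v = (((i : ℕ) + 1 : ℕ) : ℕ∞) := by
  constructor
  · intro h
    obtain ⟨i, hi, he⟩ := exists_edist_eq_succ hne h
    exact ⟨⟨i, hi.trans_le hd⟩, hi, he⟩
  · rintro ⟨i, hi, he⟩
    rw [he]
    exact_mod_cast hi

lemma exists_edist_eq_succ_of_mem_support {u v x : V} (p : G.Walk u v) (hx : x ∈ p.support)
    (hu : u ≠ x) (hv : v ≠ x) :
    ∃ a b : ℕ, a + 1 + (b + 1) ≤ p.length ∧ G.edist u x = ((a + 1 : ℕ) : ℕ∞) ∧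
      G.edist v x = ((b + 1 : ℕ) : ℕ∞) := by
  classical
  have h₁ := edist_le (p.takeUntil x hx)
  have h₂ := edist_le (p.dropUntil x hx)
  rw [edist_comm] at h₂
  have hlen := congrArg Walk.length (p.take_spec hx)
  rw [Walk.length_append] at hlen
  obtain ⟨a, ha, hae⟩ := exists_edist_eq_succ hu h₁
  obtain ⟨b, hb, hbe⟩ := exists_edist_eq_succ hv h₂
  exact ⟨a, b, by omega, hae, hbe⟩

lemma edist_le_of_edist_eq_succ {u v x : V} {a b d : ℕ} (hd : a + 1 + (b + 1) ≤ d)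
    (hu : G.edist u x = ((a + 1 : ℕ) : ℕ∞)) (hv : G.edist v x = ((b + 1 : ℕ) : ℕ∞)) :
    G.edist u v ≤ (d : ℕ∞) := by
  refine (G.edist_triangle (v := x)).trans ?_
  rw [edist_comm (u := x), hu, hv]
  exact_mod_cast hd

lemma edist_le_iff_induce_compl_range {m N d : ℕ} (w : Fin m → V) (hd : d ≤ N)
    (x y : ({x : V | x ∉ Set.range w} : Set V)) :
    G.edist (x : V) y ≤ (d : ℕ∞) ↔
      (G.induce {x : V | x ∉ Set.range w}).edist x y ≤ (d : ℕ∞) ∨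
      ∃ t : Fin m × Fin N × Fin N, (t.2.1 : ℕ) + 1 + ((t.2.2 : ℕ) + 1) ≤ d ∧
        G.edist (x : V) (w t.1) = (((t.2.1 : ℕ) + 1 : ℕ) : ℕ∞) ∧
        G.edist (y : V) (w t.1) = (((t.2.2 : ℕ) + 1 : ℕ) : ℕ∞) := by
  constructor
  · intro h
    obtain ⟨p, hp⟩ := edist_le_iff_exists_walk.mp h
    by_cases hs : ∀ z ∈ p.support, z ∈ {x : V | x ∉ Set.range w}
    · left
      refine edist_le_iff_exists_walk.mpr ⟨p.induce _ hs, ?_⟩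
      have := congrArg Walk.length (p.map_induce hs)
      rw [Walk.length_map] at this
      exact this.trans_le hp
    · right
      push Not at hs
      obtain ⟨z, hz, hzw⟩ := hs
      obtain ⟨j, rfl⟩ : z ∈ Set.range w := by simpa using hzw
      obtain ⟨a, b, hab, ha, hb⟩ := exists_edist_eq_succ_of_mem_support p hz
        (fun e => x.2 ⟨j, e.symm⟩) (fun e => y.2 ⟨j, e.symm⟩)
      exact ⟨⟨j, ⟨a, by omega⟩, ⟨b, by omega⟩⟩, by simpa using hab.trans hp, ha, hb⟩
  · rintro (h | ⟨t, ht, hx, hy⟩)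
    · obtain ⟨p, hp⟩ := edist_le_iff_exists_walk.mp h
      exact edist_le_iff_exists_walk.mpr
        ⟨p.map (Embedding.induce _).toHom, (p.length_map _).trans_le hp⟩
    · exact edist_le_of_edist_eq_succ ht hx hy

lemma exists_walk_of_support_subset_range {W : Type*} {H : SimpleGraph W} {m : ℕ}
    {w : Fin m → V} {w' : Fin m → W} (heq : ∀ i j, w i = w j → w' i = w' j)
    (hadj : ∀ i j, G.Adj (w i) (w j) → H.Adj (w' i) (w' j)) {u v : V} (p : G.Walk u v)
    (hp : ∀ x ∈ p.support, x ∈ Set.range w) (i j : Fin m) (hu : w i = u) (hv : w j = v) :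
    ∃ p' : H.Walk (w' i) (w' j), p'.length ≤ p.length := by
  induction p generalizing i with
  | nil => exact ⟨Walk.nil.copy rfl (heq _ _ (hu.trans hv.symm)), by simp⟩
  | cons a p ih =>
    obtain ⟨t, ht⟩ := hp _ (List.mem_cons_of_mem _ p.start_mem_support)
    obtain ⟨p', hp'⟩ := ih (fun x hx => hp x (List.mem_cons_of_mem _ hx)) t ht hv
    exact ⟨Walk.cons (hadj _ _ (by rwa [hu, ht])) p', by simpa using hp'⟩

lemma edist_le_of_transfer {W : Type*} {H : SimpleGraph W} {m N d : ℕ}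
    {w : Fin m → V} {w' : Fin m → W} (heq : ∀ i j, w i = w j → w' i = w' j)
    (hadj : ∀ i j, G.Adj (w i) (w j) → H.Adj (w' i) (w' j))
    (hex : ∀ (i j : Fin m) (a b : Fin N),
      (∃ x : ({x : V | x ∉ Set.range w} : Set V),
        G.edist (x : V) (w i) = (((a : ℕ) + 1 : ℕ) : ℕ∞) ∧
        G.edist (x : V) (w j) = (((b : ℕ) + 1 : ℕ) : ℕ∞)) →
      ∃ x : W, H.edist x (w' i) = (((a : ℕ) + 1 : ℕ) : ℕ∞) ∧
        H.edist x (w' j) = (((b : ℕ) + 1 : ℕ) : ℕ∞))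
    (hd : d ≤ N) (i j : Fin m) (h : G.edist (w i) (w j) ≤ (d : ℕ∞)) :
    H.edist (w' i) (w' j) ≤ (d : ℕ∞) := by
  obtain ⟨p, hp⟩ := edist_le_iff_exists_walk.mp h
  by_cases hs : ∀ x ∈ p.support, x ∈ Set.range w
  · obtain ⟨p', hp'⟩ := exists_walk_of_support_subset_range heq hadj p hs i j rfl rfl
    exact edist_le_iff_exists_walk.mpr ⟨p', hp'.trans hp⟩
  · push Not at hs
    obtain ⟨x, hx, hxw⟩ := hs
    obtain ⟨a, b, hab, ha, hb⟩ := exists_edist_eq_succ_of_mem_support p hx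
      (fun e => hxw ⟨i, e⟩) (fun e => hxw ⟨j, e⟩)
    obtain ⟨y, hya, hyb⟩ := hex i j ⟨a, by omega⟩ ⟨b, by omega⟩
      ⟨⟨x, hxw⟩, by rw [edist_comm, ha], by rw [edist_comm, hb]⟩
    rw [edist_comm] at hya hyb
    exact edist_le_of_edist_eq_succ (hab.trans hp) hya hyb

end SimpleGraph

namespace FOc

lemma QRankLe.succ {C : Type*} {q ℓ n : ℕ} (hq : 0 < q) {φ : FOc C n} (h : φ.QRankLe q ℓ) :
    φ.QRankLe q (ℓ + 1) := by
  induction φ generalizing ℓ with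
  | eq | adj | col => simp [QRankLe]
  | distLe i j d =>
    simp only [QRankLe] at h ⊢
    exact h.trans (Nat.pow_le_pow_right (by omega) (by omega))
  | not φ ih =>
    simp only [QRankLe] at h ⊢
    exact ih h
  | or φ ψ ihφ ihψ =>
    simp only [QRankLe] at h ⊢
    exact ⟨ihφ h.1, ihψ h.2⟩
  | ex φ ih =>
    cases ℓ with
    | zero => exact absurd h (by simp [QRankLe])
    | succ ℓ =>
      simp only [QRankLe] at h ⊢
      exact ih h

/-- The predicates `A` on `G₁` and `B` on `G₂` are the same constant, or are defined by one
formula of `q`-rank at most `ℓ`. -/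
def CommonlyDefinable {C V₁ V₂ : Type*} (G₁ : SimpleGraph V₁) (P₁ : C → Set V₁)
    (G₂ : SimpleGraph V₂) (P₂ : C → Set V₂) (q ℓ : ℕ) {p : ℕ}
    (A : (Fin p → V₁) → Prop) (B : (Fin p → V₂) → Prop) : Prop :=
  (∃ c : Prop, (∀ v, A v ↔ c) ∧ ∀ v, B v ↔ c) ∨
  ∃ ψ : FOc C p, ψ.QRankLe q ℓ ∧ (∀ v, A v ↔ ψ.Realize G₁ P₁ v) ∧
    ∀ v, B v ↔ ψ.Realize G₂ P₂ v

namespace CommonlyDefinable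

variable {C V₁ V₂ : Type*} {G₁ : SimpleGraph V₁} {P₁ : C → Set V₁}
  {G₂ : SimpleGraph V₂} {P₂ : C → Set V₂} {q ℓ p : ℕ}
  {A A' : (Fin p → V₁) → Prop} {B B' : (Fin p → V₂) → Prop}

lemma const {a b : Prop} (h : a ↔ b) :
    CommonlyDefinable G₁ P₁ G₂ P₂ q ℓ (p := p) (fun _ => a) (fun _ => b) :=
  Or.inl ⟨b, fun _ => h, fun _ => Iff.rfl⟩

lemma of_formula (ψ : FOc C p) (hψ : ψ.QRankLe q ℓ) :
    CommonlyDefinable G₁ P₁ G₂ P₂ q ℓ (fun v => ψ.Realize G₁ P₁ v)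
      (fun v => ψ.Realize G₂ P₂ v) :=
  Or.inr ⟨ψ, hψ, fun _ => Iff.rfl, fun _ => Iff.rfl⟩

lemma succ (h : CommonlyDefinable G₁ P₁ G₂ P₂ q ℓ A B) (hq : 0 < q) :
    CommonlyDefinable G₁ P₁ G₂ P₂ q (ℓ + 1) A B := by
  rcases h with h | ⟨ψ, hψ, h⟩
  exacts [Or.inl h, Or.inr ⟨ψ, hψ.succ hq, h⟩]

lemma congr (h : CommonlyDefinable G₁ P₁ G₂ P₂ q ℓ A B) (hA : ∀ v, A' v ↔ A v)
    (hB : ∀ v, B' v ↔ B v) : CommonlyDefinable G₁ P₁ G₂ P₂ q ℓ A' B' := by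
  rwa [show A' = A from funext fun v => propext (hA v),
    show B' = B from funext fun v => propext (hB v)]

lemma not (h : CommonlyDefinable G₁ P₁ G₂ P₂ q ℓ A B) :
    CommonlyDefinable G₁ P₁ G₂ P₂ q ℓ (fun v => ¬ A v) (fun v => ¬ B v) := by
  rcases h with ⟨c, hA, hB⟩ | ⟨ψ, hψ, hA, hB⟩
  · exact Or.inl ⟨¬ c, fun v => not_congr (hA v), fun v => not_congr (hB v)⟩
  · exact Or.inr ⟨.not ψ, hψ, fun v => not_congr (hA v), fun v => not_congr (hB v)⟩

lemma or (h : CommonlyDefinable G₁ P₁ G₂ P₂ q ℓ A B)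
    (h' : CommonlyDefinable G₁ P₁ G₂ P₂ q ℓ A' B') :
    CommonlyDefinable G₁ P₁ G₂ P₂ q ℓ (fun v => A v ∨ A' v) (fun v => B v ∨ B' v) := by
  rcases h with ⟨c, hA, hB⟩ | ⟨ψ, hψ, hA, hB⟩
  · by_cases hc : c
    · exact (const Iff.rfl (a := True)).congr (by simp [hA, hc]) (by simp [hB, hc])
    · exact h'.congr (by simp [hA, hc]) (by simp [hB, hc])
  · rcases h' with ⟨c, hA', hB'⟩ | ⟨ψ', hψ', hA', hB'⟩
    · by_cases hc : c
      · exact (const Iff.rfl (a := True)).congr (by simp [hA', hc]) (by simp [hB', hc])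
      · exact Or.inr ⟨ψ, hψ, by simpa [hA', hc] using hA, by simpa [hB', hc] using hB⟩
    · exact Or.inr ⟨.or ψ ψ', ⟨hψ, hψ'⟩, fun v => or_congr (hA v) (hA' v),
        fun v => or_congr (hB v) (hB' v)⟩

lemma and (h : CommonlyDefinable G₁ P₁ G₂ P₂ q ℓ A B)
    (h' : CommonlyDefinable G₁ P₁ G₂ P₂ q ℓ A' B') :
    CommonlyDefinable G₁ P₁ G₂ P₂ q ℓ (fun v => A v ∧ A' v) (fun v => B v ∧ B' v) :=
  (h.not.or h'.not).not.congr (fun _ => by tauto) (fun _ => by tauto)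

lemma exists_finite {ι : Type*} [Finite ι] {A : ι → (Fin p → V₁) → Prop}
    {B : ι → (Fin p → V₂) → Prop}
    (h : ∀ i, CommonlyDefinable G₁ P₁ G₂ P₂ q ℓ (A i) (B i)) :
    CommonlyDefinable G₁ P₁ G₂ P₂ q ℓ (fun v => ∃ i, A i v) (fun v => ∃ i, B i v) := by
  classical
  have := Fintype.ofFinite ι
  suffices H : ∀ s : Finset ι, CommonlyDefinable G₁ P₁ G₂ P₂ q ℓ
      (fun v => ∃ i ∈ s, A i v) (fun v => ∃ i ∈ s, B i v) from
    (H Finset.univ).congr (by simp) (by simp)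
  intro s
  induction s using Finset.induction_on with
  | empty => exact (const Iff.rfl (a := False)).congr (by simp) (by simp)
  | insert i s _ ih => exact ((h i).or ih).congr (by simp) (by simp)

lemma ex {A : (Fin (p + 1) → V₁) → Prop} {B : (Fin (p + 1) → V₂) → Prop}
    (h : CommonlyDefinable G₁ P₁ G₂ P₂ q ℓ A B) :
    CommonlyDefinable G₁ P₁ G₂ P₂ q (ℓ + 1) (p := p)
      (fun v => ∃ x : V₁, A (Fin.snoc v x)) (fun v => ∃ x : V₂, B (Fin.snoc v x)) := by
  rcases h with ⟨c, hA, hB⟩ | ⟨ψ, hψ, hA, hB⟩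
  · by_cases hc : c
    · refine Or.inr ⟨.ex (.eq (Fin.last p) (Fin.last p)), trivial, ?_, ?_⟩ <;>
        simp [hA, hB, hc, FOc.Realize]
    · exact (const Iff.rfl (a := False)).congr (by simp [hA, hc]) (by simp [hB, hc])
  · exact Or.inr ⟨.ex ψ, hψ, fun v => exists_congr fun x => hA _,
      fun v => exists_congr fun x => hB _⟩

end CommonlyDefinable

/-- The colours of the graph obtained by deleting `w`: the old ones, and for each `i < N` and each
`j` the set of vertices at distance `i + 1` from `w j`. -/
def deletionColour {C V : Type*} (G : SimpleGraph V) (P : C → Set V) {m : ℕ} (w : Fin m → V)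
    (N : ℕ) : C ⊕ (Fin N × Fin m) → Set ({x : V | x ∉ Set.range w} : Set V) :=
  fun c => match c with
    | Sum.inl c => {x | (x : V) ∈ P c}
    | Sum.inr (i, j) => {x | G.edist (x : V) (w j) = ((i : ℕ) + 1 : ℕ)}

/-- `A` and `B` are commonly definable in the graphs obtained by deleting `w₁` and `w₂`. -/
abbrev DeletionDefinable {C V₁ V₂ : Type*} (G₁ : SimpleGraph V₁) (P₁ : C → Set V₁)
    (G₂ : SimpleGraph V₂) (P₂ : C → Set V₂) {m : ℕ} (w₁ : Fin m → V₁) (w₂ : Fin m → V₂)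
    (N q ℓ : ℕ) {p : ℕ} (A : (Fin p → ({x : V₁ | x ∉ Set.range w₁} : Set V₁)) → Prop)
    (B : (Fin p → ({x : V₂ | x ∉ Set.range w₂} : Set V₂)) → Prop) : Prop :=
  CommonlyDefinable (G₁.induce {x : V₁ | x ∉ Set.range w₁}) (deletionColour G₁ P₁ w₁ N)
    (G₂.induce {x : V₂ | x ∉ Set.range w₂}) (deletionColour G₂ P₂ w₂ N) q ℓ A B

/-- The tuple of vertices of `G` read off from a tuple `v` of remaining and the tuple `w` of
deleted vertices. -/
def mergeTuple {V : Type*} {m n p : ℕ} (w : Fin m → V) (s : Fin n → Fin p ⊕ Fin m)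
    (v : Fin p → ({x : V | x ∉ Set.range w} : Set V)) : Fin n → V :=
  fun t => Sum.elim (fun i => (v i : V)) w (s t)

lemma mergeTuple_inl {V : Type*} {m n p : ℕ} {w : Fin m → V} {s : Fin n → Fin p ⊕ Fin m}
    {t : Fin n} {a : Fin p} (h : s t = Sum.inl a)
    (v : Fin p → ({x : V | x ∉ Set.range w} : Set V)) : mergeTuple w s v t = v a := by
  simp [mergeTuple, h]

lemma mergeTuple_inr {V : Type*} {m n p : ℕ} {w : Fin m → V} {s : Fin n → Fin p ⊕ Fin m}
    {t : Fin n} {j : Fin m} (h : s t = Sum.inr j)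
    (v : Fin p → ({x : V | x ∉ Set.range w} : Set V)) : mergeTuple w s v t = w j := by
  simp [mergeTuple, h]

lemma snoc_mergeTuple_remaining {V : Type*} {m n p : ℕ} (w : Fin m → V)
    (s : Fin n → Fin p ⊕ Fin m) (v : Fin p → ({x : V | x ∉ Set.range w} : Set V))
    (x : ({x : V | x ∉ Set.range w} : Set V)) :
    (Fin.snoc (mergeTuple w s v) (x : V) : Fin (n + 1) → V) =
      mergeTuple w (Fin.snoc (α := fun _ => Fin (p + 1) ⊕ Fin m)
        (fun t => Sum.map Fin.castSucc id (s t)) (Sum.inl (Fin.last p)))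
        (Fin.snoc (α := fun _ => ({x : V | x ∉ Set.range w} : Set V)) v x) := by
  funext t
  refine Fin.lastCases ?_ (fun t => ?_) t
  · simp [mergeTuple]
  · cases hs : s t <;> simp [mergeTuple, hs]

lemma snoc_mergeTuple_deleted {V : Type*} {m n p : ℕ} (w : Fin m → V)
    (s : Fin n → Fin p ⊕ Fin m) (v : Fin p → ({x : V | x ∉ Set.range w} : Set V)) (j : Fin m) :
    (Fin.snoc (mergeTuple w s v) (w j) : Fin (n + 1) → V) =
      mergeTuple w (Fin.snoc (α := fun _ => Fin p ⊕ Fin m) s (Sum.inr j)) v := by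
  funext t
  refine Fin.lastCases ?_ (fun t => ?_) t <;> simp [mergeTuple]

lemma exists_snoc_mergeTuple_iff {V : Type*} {m n p : ℕ} (w : Fin m → V)
    (s : Fin n → Fin p ⊕ Fin m) (v : Fin p → ({x : V | x ∉ Set.range w} : Set V))
    (R : (Fin (n + 1) → V) → Prop) :
    (∃ x : V, R (Fin.snoc (mergeTuple w s v) x)) ↔
      (∃ x : ({x : V | x ∉ Set.range w} : Set V),
        R (mergeTuple w (Fin.snoc (α := fun _ => Fin (p + 1) ⊕ Fin m)
          (fun t => Sum.map Fin.castSucc id (s t)) (Sum.inl (Fin.last p)))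
          (Fin.snoc (α := fun _ => ({x : V | x ∉ Set.range w} : Set V)) v x))) ∨
      ∃ j : Fin m, R (mergeTuple w (Fin.snoc (α := fun _ => Fin p ⊕ Fin m) s (Sum.inr j)) v) := by
  simp only [← snoc_mergeTuple_remaining, ← snoc_mergeTuple_deleted]
  constructor
  · rintro ⟨x, hx⟩
    by_cases hxw : x ∈ Set.range w
    · obtain ⟨j, rfl⟩ := hxw
      exact Or.inr ⟨j, hx⟩
    · exact Or.inl ⟨⟨x, hxw⟩, hx⟩
  · rintro (⟨x, hx⟩ | ⟨j, hj⟩)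
    exacts [⟨x, hx⟩, ⟨w j, hj⟩]

lemma append_eq_mergeTuple {V : Type*} {m k : ℕ} (w : Fin m → V)
    (v : Fin k → ({x : V | x ∉ Set.range w} : Set V)) :
    Fin.append (fun i => (v i : V)) w = mergeTuple w finSumFinEquiv.symm v := by
  funext t
  refine Fin.addCases (fun i => ?_) (fun i => ?_) t <;> simp [mergeTuple]

section Deletion

variable {C V₁ V₂ : Type*} {G₁ : SimpleGraph V₁} {P₁ : C → Set V₁}
  {G₂ : SimpleGraph V₂} {P₂ : C → Set V₂} {m : ℕ} {w₁ : Fin m → V₁} {w₂ : Fin m → V₂}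
  {N q ℓ : ℕ}

lemma deletionDefinable_edist_eq {p : ℕ} (a : Fin p) (i : Fin N) (j : Fin m) :
    DeletionDefinable G₁ P₁ G₂ P₂ w₁ w₂ N q ℓ
      (fun v => G₁.edist (v a : V₁) (w₁ j) = (((i : ℕ) + 1 : ℕ) : ℕ∞))
      (fun v => G₂.edist (v a : V₂) (w₂ j) = (((i : ℕ) + 1 : ℕ) : ℕ∞)) :=
  CommonlyDefinable.of_formula (.col (Sum.inr (i, j)) a) trivial

lemma deletionDefinable_edist_le {p d : ℕ} (hd : d ≤ N) (a : Fin p) (j : Fin m) :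
    DeletionDefinable G₁ P₁ G₂ P₂ w₁ w₂ N q ℓ
      (fun v => G₁.edist (v a : V₁) (w₁ j) ≤ (d : ℕ∞))
      (fun v => G₂.edist (v a : V₂) (w₂ j) ≤ (d : ℕ∞)) := by
  refine (CommonlyDefinable.exists_finite fun i : Fin N =>
    (CommonlyDefinable.const (Iff.refl ((i : ℕ) + 1 ≤ d))).and
      (deletionDefinable_edist_eq a i j)).congr ?_ ?_
  · exact fun v => SimpleGraph.edist_le_iff_exists_edist_eq_succ hd fun e => (v a).2 ⟨j, e.symm⟩
  · exact fun v => SimpleGraph.edist_le_iff_exists_edist_eq_succ hd fun e => (v a).2 ⟨j, e.symm⟩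

lemma deletionDefinable_edist_le_pair {p d : ℕ} (hd : d ≤ N) (hdq : d ≤ (4 * q) ^ (q + ℓ))
    (a b : Fin p) :
    DeletionDefinable G₁ P₁ G₂ P₂ w₁ w₂ N q ℓ
      (fun v => G₁.edist (v a : V₁) (v b) ≤ (d : ℕ∞))
      (fun v => G₂.edist (v a : V₂) (v b) ≤ (d : ℕ∞)) :=
  ((CommonlyDefinable.of_formula (.distLe a b d) (by simpa only [QRankLe] using hdq)).or
    (CommonlyDefinable.exists_finite fun t : Fin m × Fin N × Fin N =>
      (CommonlyDefinable.const
        (Iff.refl ((t.2.1 : ℕ) + 1 + ((t.2.2 : ℕ) + 1) ≤ d))).and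
        ((deletionDefinable_edist_eq a t.2.1 t.1).and
          (deletionDefinable_edist_eq b t.2.2 t.1)))).congr
    (fun v => SimpleGraph.edist_le_iff_induce_compl_range w₁ hd (v a) (v b))
    (fun v => SimpleGraph.edist_le_iff_induce_compl_range w₂ hd (v a) (v b))

lemma deletionDefinable_adj {p : ℕ} (hN : 1 ≤ N) (a : Fin p) (j : Fin m) :
    DeletionDefinable G₁ P₁ G₂ P₂ w₁ w₂ N q ℓ
      (fun v => G₁.Adj (v a : V₁) (w₁ j)) (fun v => G₂.Adj (v a : V₂) (w₂ j)) := by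
  refine (deletionDefinable_edist_eq a ⟨0, hN⟩ j).congr (fun v => ?_) (fun v => ?_) <;>
    simp

lemma deletionDefinable_realize (hN : 1 ≤ N) (heq : ∀ i j, w₁ i = w₁ j ↔ w₂ i = w₂ j)
    (hadj : ∀ i j, G₁.Adj (w₁ i) (w₁ j) ↔ G₂.Adj (w₂ i) (w₂ j))
    (hcol : ∀ c i, w₁ i ∈ P₁ c ↔ w₂ i ∈ P₂ c)
    (hdist : ∀ i j, ∀ d ≤ N, G₁.edist (w₁ i) (w₁ j) ≤ (d : ℕ∞) ↔
      G₂.edist (w₂ i) (w₂ j) ≤ (d : ℕ∞))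
    {n : ℕ} (φ : FOc C n) {ℓ : ℕ} (hℓ : ℓ ≤ q) (hℓN : ∀ r ≤ ℓ, (4 * q) ^ (q + r) ≤ N)
    (hφ : φ.QRankLe q ℓ) {p : ℕ} (s : Fin n → Fin p ⊕ Fin m) :
    DeletionDefinable G₁ P₁ G₂ P₂ w₁ w₂ N q ℓ
      (fun v => φ.Realize G₁ P₁ (mergeTuple w₁ s v))
      (fun v => φ.Realize G₂ P₂ (mergeTuple w₂ s v)) := by
  induction φ generalizing ℓ p with
  | eq i j =>
    simp only [FOc.Realize]
    cases hi : s i with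
    | inl a =>
      cases hj : s j with
      | inl b =>
        simp only [mergeTuple_inl hi, mergeTuple_inl hj]
        exact (CommonlyDefinable.of_formula (.eq a b) (by simp only [QRankLe])).congr
          (fun v => Subtype.ext_iff.symm) (fun v => Subtype.ext_iff.symm)
      | inr b =>
        simp only [mergeTuple_inl hi, mergeTuple_inr hj]
        exact (CommonlyDefinable.const (Iff.refl False)).congr
          (fun v => iff_false_intro fun e => (v a).2 ⟨b, e.symm⟩)
          (fun v => iff_false_intro fun e => (v a).2 ⟨b, e.symm⟩)
    | inr a =>
      cases hj : s j with
      | inl b =>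
        simp only [mergeTuple_inr hi, mergeTuple_inl hj]
        exact (CommonlyDefinable.const (Iff.refl False)).congr
          (fun v => iff_false_intro fun e => (v b).2 ⟨a, e⟩)
          (fun v => iff_false_intro fun e => (v b).2 ⟨a, e⟩)
      | inr b =>
        simp only [mergeTuple_inr hi, mergeTuple_inr hj]
        exact CommonlyDefinable.const (heq a b)
  | adj i j =>
    simp only [FOc.Realize]
    cases hi : s i with
    | inl a =>
      cases hj : s j with
      | inl b =>
        simp only [mergeTuple_inl hi, mergeTuple_inl hj]
        exact CommonlyDefinable.of_formula (.adj a b) trivial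
      | inr b =>
        simp only [mergeTuple_inl hi, mergeTuple_inr hj]
        exact deletionDefinable_adj hN a b
    | inr a =>
      cases hj : s j with
      | inl b =>
        simp only [mergeTuple_inr hi, mergeTuple_inl hj]
        exact (deletionDefinable_adj hN b a).congr
          (fun v => G₁.adj_comm _ _) (fun v => G₂.adj_comm _ _)
      | inr b =>
        simp only [mergeTuple_inr hi, mergeTuple_inr hj]
        exact CommonlyDefinable.const (hadj a b)
  | col c i =>
    simp only [FOc.Realize]
    cases hi : s i with
    | inl a =>
      simp only [mergeTuple_inl hi]
      exact CommonlyDefinable.of_formula (.col (Sum.inl c) a) trivial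
    | inr a =>
      simp only [mergeTuple_inr hi]
      exact CommonlyDefinable.const (hcol c a)
  | distLe i j d =>
    have hdq : d ≤ (4 * q) ^ (q + ℓ) := by simpa only [FOc.QRankLe] using hφ
    have hd : d ≤ N := hdq.trans (hℓN ℓ le_rfl)
    simp only [FOc.Realize]
    cases hi : s i with
    | inl a =>
      cases hj : s j with
      | inl b =>
        simp only [mergeTuple_inl hi, mergeTuple_inl hj]
        exact deletionDefinable_edist_le_pair hd hdq a b
      | inr b =>
        simp only [mergeTuple_inl hi, mergeTuple_inr hj]
        exact deletionDefinable_edist_le hd a b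
    | inr a =>
      cases hj : s j with
      | inl b =>
        simp only [mergeTuple_inr hi, mergeTuple_inl hj]
        exact (deletionDefinable_edist_le hd b a).congr
          (fun v => by rw [SimpleGraph.edist_comm]) (fun v => by rw [SimpleGraph.edist_comm])
      | inr b =>
        simp only [mergeTuple_inr hi, mergeTuple_inr hj]
        exact CommonlyDefinable.const (hdist a b d hd)
  | not φ ih =>
    exact (ih hℓ hℓN (by simpa only [FOc.QRankLe] using hφ) s).not
  | or φ ψ ihφ ihψ =>
    have hφψ : φ.QRankLe q ℓ ∧ ψ.QRankLe q ℓ := by simpa only [FOc.QRankLe] using hφ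
    exact (ihφ hℓ hℓN hφψ.1 s).or (ihψ hℓ hℓN hφψ.2 s)
  | ex φ ih =>
    cases ℓ with
    | zero => exact absurd hφ (by simp [FOc.QRankLe])
    | succ ℓ =>
      have hφ' : φ.QRankLe q ℓ := by simpa only [FOc.QRankLe] using hφ
      have hℓN' : ∀ r ≤ ℓ, (4 * q) ^ (q + r) ≤ N := fun r hr => hℓN r (by omega)
      exact ((ih (by omega) hℓN' hφ' _).ex.or (CommonlyDefinable.exists_finite fun j : Fin m =>
        (ih (by omega) hℓN' hφ' _).succ (by omega))).congr
        (fun v => exists_snoc_mergeTuple_iff w₁ s v _) (fun v => exists_snoc_mergeTuple_iff w₂ s v _)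

end Deletion

end FOc

/-- Let `G₁, G₂` be coloured graphs with distinguished `m`-tuples
`w₁, w₂` of the same atomic `q`-type, and let `G₁', G₂'` be obtained by deleting
these tuples and marking, for `1 ≤ i ≤ f_q(ℓ)` and `1 ≤ j ≤ m`, the vertices at
distance exactly `i` from the `j`-th deleted vertex by a fresh colour `Q_{ij}`.
If `(G₁', v₁) ≡⁺_{q,ℓ} (G₂', v₂)`, then `(G₁, v₁w₁) ≡⁺_{q,ℓ} (G₂, v₂w₂)`. -/
theorem equivPlus_delete_tuple {V₁ V₂ C : Type*}
    (G₁ : SimpleGraph V₁) (G₂ : SimpleGraph V₂)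
    (P₁ : C → Set V₁) (P₂ : C → Set V₂) (q ℓ k m : ℕ) (hℓ : ℓ ≤ q)
    (w₁ : Fin m → V₁) (w₂ : Fin m → V₂)
    (hatp : ∀ φ : FOc C m, φ.QRankLe q 0 →
      (φ.Realize G₁ P₁ w₁ ↔ φ.Realize G₂ P₂ w₂))
    (v₁ : Fin k → ({x : V₁ | x ∉ Set.range w₁} : Set V₁))
    (v₂ : Fin k → ({x : V₂ | x ∉ Set.range w₂} : Set V₂))
    (h : ∀ φ : FOc (C ⊕ (Fin ((4 * q) ^ (q + ℓ)) × Fin m)) k, φ.QRankLe q ℓ →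
      (φ.Realize (G₁.induce {x : V₁ | x ∉ Set.range w₁})
          (fun c => match c with
            | Sum.inl c => {x | (x : V₁) ∈ P₁ c}
            | Sum.inr (i, j) => {x | G₁.edist (x : V₁) (w₁ j) = ((i : ℕ) + 1 : ℕ)})
          v₁ ↔
       φ.Realize (G₂.induce {x : V₂ | x ∉ Set.range w₂})
          (fun c => match c with
            | Sum.inl c => {x | (x : V₂) ∈ P₂ c}
            | Sum.inr (i, j) => {x | G₂.edist (x : V₂) (w₂ j) = ((i : ℕ) + 1 : ℕ)})
          v₂)) :
    ∀ φ : FOc C (k + m), φ.QRankLe q ℓ →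
      (φ.Realize G₁ P₁ (Fin.append (fun i => (v₁ i : V₁)) w₁) ↔
       φ.Realize G₂ P₂ (Fin.append (fun i => (v₂ i : V₂)) w₂)) := by
  have heq : ∀ i j, w₁ i = w₁ j ↔ w₂ i = w₂ j := fun i j => hatp (.eq i j) trivial
  have hadj : ∀ i j, G₁.Adj (w₁ i) (w₁ j) ↔ G₂.Adj (w₂ i) (w₂ j) :=
    fun i j => hatp (.adj i j) trivial
  have hcol : ∀ c i, w₁ i ∈ P₁ c ↔ w₂ i ∈ P₂ c := fun c i => hatp (.col c i) trivial
  have hN : 1 ≤ (4 * q) ^ (q + ℓ) := by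
    rcases Nat.eq_zero_or_pos q with rfl | hq
    · simp [Nat.le_zero.mp hℓ]
    · exact Nat.one_le_pow _ _ (by omega)
  have hℓN : ∀ r ≤ ℓ, (4 * q) ^ (q + r) ≤ (4 * q) ^ (q + ℓ) := by
    intro r hr
    rcases Nat.eq_zero_or_pos q with rfl | hq
    · rw [Nat.le_zero.mp hℓ] at hr ⊢
      rw [Nat.le_zero.mp hr]
    · exact Nat.pow_le_pow_right (by omega) (by omega)
  have hdist : ∀ i j, ∀ d ≤ (4 * q) ^ (q + ℓ), G₁.edist (w₁ i) (w₁ j) ≤ (d : ℕ∞) ↔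
      G₂.edist (w₂ i) (w₂ j) ≤ (d : ℕ∞) := by
    intro i j d hd
    cases ℓ with
    | zero => exact hatp (.distLe i j d) hd
    | succ ℓ =>
      have hex (i j : Fin m) (a b : Fin ((4 * q) ^ (q + (ℓ + 1)))) :=
        h (.ex (.not (.or (.not (.col (Sum.inr (a, i)) (Fin.last k)))
          (.not (.col (Sum.inr (b, j)) (Fin.last k)))))) ⟨trivial, trivial⟩
      simp only [FOc.Realize, Fin.snoc_last, not_or, not_not] at hex
      constructor
      · refine SimpleGraph.edist_le_of_transfer (fun i j => (heq i j).mp)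
          (fun i j => (hadj i j).mp) (fun i j a b hx => ?_) hd i j
        obtain ⟨y, hy⟩ := (hex i j a b).mp hx
        exact ⟨y, hy⟩
      · refine SimpleGraph.edist_le_of_transfer (fun i j => (heq i j).mpr)
          (fun i j => (hadj i j).mpr) (fun i j a b hx => ?_) hd i j
        obtain ⟨y, hy⟩ := (hex i j a b).mpr hx
        exact ⟨y, hy⟩
  intro φ hφ
  have hdef := FOc.deletionDefinable_realize hN heq hadj hcol hdist φ hℓ hℓN hφ
    (finSumFinEquiv (m := k) (n := m)).symm
  rw [FOc.append_eq_mergeTuple, FOc.append_eq_mergeTuple]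
  rcases hdef with ⟨c, hA, hB⟩ | ⟨ψ, hψ, hA, hB⟩
  · exact (hA v₁).trans (hB v₂).symm
  · refine (hA v₁).trans (Iff.trans ?_ (hB v₂).symm)
    convert h ψ hψ using 2 <;>
    · funext c
      rcases c with c | ⟨i, j⟩ <;> rfl
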